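/- Let m, n, q be positive integers with mn ≥ 2 and q ≥ 1, and let θ be a real number with 0 < θ < 1. Let h : ℝ → ℝ be the Kotz type I generator h(x) = [θ^{(2q+mn-2)/2} Γ(mn/2) / (π^{mn/2} Γ((2q+mn-2)/2))] · x^{q-1} e^{-θx}. Then for every natural number k, the absolute value of the k-th derivative of h at 0 satisfies |h^{(k)}(0)| ≤ θ^{mn/2 + k} · k^{q-1} / π^{mn/2} (with the convention 0^0 = 1 when k = 0 and q = 1). -/

import Mathlib

open Real

theorem iteratedDeriv_pow_mul_exp_zero (p k : ℕ) (c : ℝ) :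
    iteratedDeriv k (fun x : ℝ => x ^ p * Real.exp (c * x)) 0 =
      k.descFactorial p * c ^ (k - p) := by
  rw [iteratedDeriv_fun_mul (by fun_prop) (by fun_prop)]
  simp only [iteratedDeriv_fun_pow_zero, iteratedDeriv_exp_const_mul, mul_zero, Real.exp_zero,
    mul_one]
  by_cases hp : p ≤ k
  · rw [Finset.sum_eq_single p]
    · simp [Nat.descFactorial_eq_factorial_mul_choose, mul_comm]
    · intro i _ hi
      simp [hi]
    · intro hp'
      exact absurd (Finset.mem_range.2 (Nat.lt_succ_of_le hp)) hp'
  · rw [Nat.descFactorial_of_lt (not_le.1 hp), Finset.sum_eq_zero]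
    · simp
    · intro i hi
      have : i ≠ p := by have := Finset.mem_range.1 hi; omega
      simp [this]

theorem Real.Gamma_le_Gamma_add_natCast {a : ℝ} (ha : 1 ≤ a) (p : ℕ) :
    Real.Gamma a ≤ Real.Gamma (a + p) := by
  induction p with
  | zero => simp
  | succ p ih =>
    have hap : 1 ≤ a + p := le_add_of_le_of_nonneg ha p.cast_nonneg
    rw [Nat.cast_succ, ← add_assoc, Real.Gamma_add_one (by positivity)]
    exact ih.trans (le_mul_of_one_le_left (Real.Gamma_pos_of_pos (by positivity)).le hap)

/-- For the Kotz type I generator `h` with `0 < θ < 1`, `mn ≥ 2`, `q ≥ 1`, the `k`-th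
derivative at `0` satisfies `|h^{(k)}(0)| ≤ θ^{mn/2 + k} k^{q-1} / π^{mn/2}`. -/
theorem stmt_3 (m n q : ℕ) (hm : 0 < m) (hn : 0 < n) (hq : 1 ≤ q) (hmn : 2 ≤ m * n)
    (θ : ℝ) (hθ0 : 0 < θ) (hθ1 : θ < 1) (h : ℝ → ℝ)
    (hh : ∀ x : ℝ, h x =
      θ ^ (((2 * q + m * n : ℝ) - 2) / 2) * Real.Gamma ((m * n : ℝ) / 2) /
        (π ^ ((m * n : ℝ) / 2) * Real.Gamma (((2 * q + m * n : ℝ) - 2) / 2)) *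
        (x ^ (q - 1) * Real.exp (-θ * x))) (k : ℕ) :
    |iteratedDeriv k h 0| ≤ θ ^ ((m * n : ℝ) / 2 + k) * (k : ℝ) ^ (q - 1) / π ^ ((m * n : ℝ) / 2) := by
  obtain ⟨p, rfl⟩ := Nat.exists_eq_add_of_le' hq
  have ha : (1 : ℝ) ≤ (m * n : ℝ) / 2 := by
    have : (2 : ℝ) ≤ m * n := by exact_mod_cast hmn
    linarith
  have hexp : ((2 * (p + 1 : ℕ) + m * n : ℝ) - 2) / 2 = (m * n : ℝ) / 2 + p := by
    push_cast
    ring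
  simp only [hexp, Nat.add_sub_cancel] at hh ⊢
  rw [funext hh, iteratedDeriv_const_mul_field, iteratedDeriv_pow_mul_exp_zero]
  generalize (m * n : ℝ) / 2 = a at ha ⊢
  have hΓ : 0 < Real.Gamma (a + p) := Real.Gamma_pos_of_pos (by positivity)
  have hΓa : 0 < Real.Gamma a := Real.Gamma_pos_of_pos (by positivity)
  rcases lt_or_ge k p with hkp | hkp
  · rw [Nat.descFactorial_of_lt hkp]
    simp only [Nat.cast_zero, zero_mul, mul_zero, abs_zero]
    positivity
  have hθ : θ ^ (a + p) * θ ^ (k - p) = θ ^ (a + k) := by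
    rw [← Real.rpow_natCast θ (k - p), ← Real.rpow_add hθ0, Nat.cast_sub hkp]
    ring_nf
  have hquot : Real.Gamma a / Real.Gamma (a + p) ≤ 1 :=
    (div_le_one hΓ).2 (Real.Gamma_le_Gamma_add_natCast ha p)
  have hdesc : (k.descFactorial p : ℝ) ≤ (k : ℝ) ^ p := by
    exact_mod_cast Nat.descFactorial_le_pow k p
  calc
    _ = θ ^ (a + p) * Real.Gamma a / (π ^ a * Real.Gamma (a + p)) *
          (k.descFactorial p * θ ^ (k - p)) := by
      rw [abs_mul, abs_mul, abs_pow, abs_neg, abs_of_pos hθ0, Nat.abs_cast,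
        abs_of_pos (by positivity)]
    _ = θ ^ (a + k) / π ^ a * (Real.Gamma a / Real.Gamma (a + p) * k.descFactorial p) := by
      rw [← hθ]
      field_simp
    _ ≤ θ ^ (a + k) / π ^ a * (1 * (k : ℝ) ^ p) := by gcongr
    _ = θ ^ (a + k) * (k : ℝ) ^ p / π ^ a := by ring
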